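/- (q-extension of Newton's inequalities) Let n ∈ ℕ, q ∈ (0,1], and suppose F(z) = ∑_{k=0}^n C_k^n(q) a_k z^k belongs to 𝓡_n(q). Then f(z) := ∑_{k=0}^n a_k z^k belongs to 𝓛𝓒_n, i.e. a_k² > a_{k−1}a_{k+1} for every index k for which there exist l ≤ k and m ≥ k with a_l ≠ 0 and a_m ≠ 0. If moreover F ∈ 𝓝_n(q), then f ∈ 𝓛𝓒_n⁺. -/

import Mathlib

open Polynomial Filter

open scoped Classical

noncomputable section

/-- `R_n(q;z) = ∏_{j=1}^n (1 + q^{j-1} z)`, the generating polynomial of the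
q-binomial coefficients. -/
def Rpoly (n : ℕ) (q : ℝ) : Polynomial ℝ :=
  ∏ j ∈ Finset.range n, (1 + Polynomial.C (q ^ j) * Polynomial.X)

/-- The q-binomial coefficient `C_k^n(q)`. -/
def qBinom (n k : ℕ) (q : ℝ) : ℝ := (Rpoly n q).coeff k

/-- The weighted Hadamard product `F *_q^n G`: if `F = ∑ C_k^n(q) a_k z^k` and
`G = ∑ C_k^n(q) b_k z^k`, then `F *_q^n G = ∑ C_k^n(q) a_k b_k z^k`. -/
def qHadamard (n : ℕ) (q : ℝ) (F G : Polynomial ℝ) : Polynomial ℝ :=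
  ∑ k ∈ Finset.range (n + 1),
    Polynomial.C (F.coeff k * G.coeff k / qBinom n k q) * Polynomial.X ^ k

/-- All zeros of the real polynomial `F` are real (it splits over `ℝ`). -/
def RealRooted (F : Polynomial ℝ) : Prop :=
  F = 0 ∨ F.roots.card = F.natDegree

/-- All real roots of `F` are nonpositive. -/
def OnlyNonposRoots (F : Polynomial ℝ) : Prop := ∀ x ∈ F.roots, x ≤ 0

/-- The multiset `s` (of zeros, with multiplicity) is logarithmically q-separated. -/
def LogSep (q : ℝ) (s : Multiset ℝ) : Prop :=
  (∀ x ∈ s, x ≠ 0 → 2 ≤ s.count x → (1 : ℝ) ≤ q) ∧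
  (∀ x ∈ s, ∀ y ∈ s, ((y < x ∧ x < 0) ∨ (0 < x ∧ x < y)) → x / y ≤ q)

/-- The multiset `s` (of zeros, with multiplicity) is strictly logarithmically
q-separated. -/
def StrictLogSep (q : ℝ) (s : Multiset ℝ) : Prop :=
  (∀ x ∈ s, x ≠ 0 → 2 ≤ s.count x → (1 : ℝ) < q) ∧
  (∀ x ∈ s, ∀ y ∈ s, ((y < x ∧ x < 0) ∨ (0 < x ∧ x < y)) → x / y < q)

/-- The class `𝓡̄_n(q)`. -/
def memRbar (n : ℕ) (q : ℝ) (F : Polynomial ℝ) : Prop :=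
  F.natDegree ≤ n ∧ RealRooted F ∧ LogSep q F.roots

/-- The class `𝓡_n(q)`. -/
def memR (n : ℕ) (q : ℝ) (F : Polynomial ℝ) : Prop :=
  F.natDegree ≤ n ∧ RealRooted F ∧ StrictLogSep q F.roots

/-- The class `𝓝̄_n(q)`. -/
def memNbar (n : ℕ) (q : ℝ) (F : Polynomial ℝ) : Prop :=
  memRbar n q F ∧ OnlyNonposRoots F

/-- The class `𝓝_n(q)`. -/
def memN (n : ℕ) (q : ℝ) (F : Polynomial ℝ) : Prop :=
  memR n q F ∧ OnlyNonposRoots F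

/-- `F ≼ G` : both have only real zeros and `F'G - FG' ≤ 0` on `ℝ`. -/
def Prec (F G : Polynomial ℝ) : Prop :=
  RealRooted F ∧ RealRooted G ∧
    ∀ x : ℝ, (Polynomial.derivative F * G - F * Polynomial.derivative G).eval x ≤ 0

/-- `F ≺ G` : `F ≼ G` and no common zeros. -/
def PrecS (F G : Polynomial ℝ) : Prop :=
  Prec F G ∧ ∀ x : ℝ, ¬ (F.eval x = 0 ∧ G.eval x = 0)

/-- `F ≺₀ G` : `F ≼ G` and no common zeros except possibly at the origin. -/
def Prec0 (F G : Polynomial ℝ) : Prop :=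
  Prec F G ∧ ∀ x : ℝ, x ≠ 0 → ¬ (F.eval x = 0 ∧ G.eval x = 0)

/-- `F ⋎ G` : `G ≼ zF`. -/
def Veebar (F G : Polynomial ℝ) : Prop := Prec G (Polynomial.X * F)

/-- `F ∨ G` : `F ⋎ G` and no common zeros except possibly at the origin. -/
def VeeS (F G : Polynomial ℝ) : Prop :=
  Veebar F G ∧ ∀ x : ℝ, x ≠ 0 → ¬ (F.eval x = 0 ∧ G.eval x = 0)

/-- `F ⊴ G` : `F ⋎ G` for polynomials with only nonpositive zeros. -/
def TriLE (F G : Polynomial ℝ) : Prop :=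
  OnlyNonposRoots F ∧ OnlyNonposRoots G ∧ Veebar F G

/-- `F ◁ G` : `F ∨ G` for polynomials with only nonpositive zeros. -/
def TriLT (F G : Polynomial ℝ) : Prop :=
  OnlyNonposRoots F ∧ OnlyNonposRoots G ∧ VeeS F G

/-- `F` is extremal (in `𝓡̄_n(q)` or `𝓝̄_n(q)`): `F(z) = c · R_n(q; a z)` for
nonzero reals `a`, `c`. -/
def Extremal (n : ℕ) (q : ℝ) (F : Polynomial ℝ) : Prop :=
  ∃ a c : ℝ, a ≠ 0 ∧ c ≠ 0 ∧
    F = Polynomial.C c * (Rpoly n q).comp (Polynomial.C a * Polynomial.X)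

/-- The q-difference operator `Δ_{q,n}`. -/
def qDelta (q : ℝ) (n : ℕ) (F : Polynomial ℝ) : Polynomial ℝ :=
  if q = 1 then Polynomial.C ((n : ℝ)⁻¹) * Polynomial.derivative F
  else Polynomial.C (q ^ (n - 1) - q⁻¹)⁻¹ *
    (F - F.comp (Polynomial.C q⁻¹ * Polynomial.X)).divX

/-- The operator `Δ*_{q,n}`. -/
def qDeltaStar (q : ℝ) (n : ℕ) (F : Polynomial ℝ) : Polynomial ℝ :=
  if q = 1 then F - Polynomial.C ((n : ℝ)⁻¹) * (Polynomial.X * Polynomial.derivative F)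
  else Polynomial.C (q⁻¹ ^ n - 1)⁻¹ *
    (Polynomial.C (q⁻¹ ^ n) * F - F.comp (Polynomial.C q⁻¹ * Polynomial.X))

/-- The sequence `a_0, …, a_n` is strictly log-concave (`𝓛𝓒_n`):
`a_k² > a_{k-1} a_{k+1}` for every `k` for which there are `l ≤ k` and `m ≥ k`
with `a_l ≠ 0 ≠ a_m` (with the convention `a_{-1} = 0`). -/
def LCcond (n : ℕ) (a : ℕ → ℝ) : Prop :=
  ∀ k ≤ n, (∃ l, l ≤ k ∧ a l ≠ 0) → (∃ m, k ≤ m ∧ m ≤ n ∧ a m ≠ 0) →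
    (if k = 0 then (0 : ℝ) else a (k - 1)) * a (k + 1) < a k ^ 2

/-- `σ_n(ℝ)`: the zero polynomial together with the polynomials of degree `n` or
`n-1` with only real, simple zeros. -/
def sigmaR (n : ℕ) (P : Polynomial ℝ) : Prop :=
  P = 0 ∨ ((P.natDegree = n ∨ P.natDegree + 1 = n) ∧
    P.roots.card = P.natDegree ∧ ∀ x ∈ P.roots, P.roots.count x = 1)

/-- `P` and `Q` have strictly interspersed zeros: `P'Q - PQ'` never vanishes. -/
def StrictInt (P Q : Polynomial ℝ) : Prop :=
  ∀ t : ℝ, (Polynomial.derivative P * Q - P * Polynomial.derivative Q).eval t ≠ 0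

end

/-! ### Quantum integers -/

/-- The quantum integer `[k]_q = 1 + q + ⋯ + q ^ (k - 1)`. -/
noncomputable def qInt (q : ℝ) (k : ℕ) : ℝ := ∑ i ∈ Finset.range k, q ^ i

lemma qInt_succ (q : ℝ) (k : ℕ) : qInt q (k + 1) = qInt q k + q ^ k := by
  simp [qInt, Finset.sum_range_succ]

lemma qInt_zero (q : ℝ) : qInt q 0 = 0 := by simp [qInt]

lemma qInt_one (k : ℕ) : qInt 1 k = k := by simp [qInt]

lemma one_sub_mul_qInt (q : ℝ) (k : ℕ) : (1 - q) * qInt q k = 1 - q ^ k :=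
  mul_neg_geom_sum q k

lemma qInt_nonneg {q : ℝ} (hq : 0 < q) (k : ℕ) : 0 ≤ qInt q k :=
  Finset.sum_nonneg fun _ _ => by positivity

lemma qInt_pos {q : ℝ} (hq : 0 < q) {k : ℕ} (hk : 1 ≤ k) : 0 < qInt q k := by
  obtain ⟨k, rfl⟩ := Nat.exists_eq_add_of_le' hk
  rw [qInt_succ]
  have := qInt_nonneg hq k
  positivity

lemma qInt_mul_qInt_le {q : ℝ} (hq : 0 < q) (k : ℕ) :
    qInt q k * qInt q (k + 2) ≤ qInt q (k + 1) ^ 2 := by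
  have h : qInt q (k + 1) ^ 2 - qInt q k * qInt q (k + 2) = q ^ k := by
    have h1 : (1 - q) * qInt q k = 1 - q ^ k := one_sub_mul_qInt q k
    rw [qInt_succ q (k + 1), qInt_succ q k, pow_succ]
    linear_combination (q ^ k) * h1
  have : 0 < q ^ k := by positivity
  linarith

/-- `sinh ((k + 1) τ) / sinh (k τ) ≥ (k + 1) / k`, in terms of quantum integers with
`q = r ^ 2`. -/
lemma mul_qInt_le_mul_qInt_succ {r : ℝ} (hr : 0 < r) (hr1 : r ≤ 1) (k : ℕ) :
    (k + 1) * r * qInt (r ^ 2) k ≤ k * qInt (r ^ 2) (k + 1) := by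
  induction k with
  | zero => simp [qInt]
  | succ k ih =>
    have key : ((k : ℝ) + 1) * r * (r ^ 2) ^ k ≤ qInt (r ^ 2) (k + 1) := by
      have h1 : ∑ _i ∈ Finset.range (k + 1), (r ^ 2) ^ k ≤ qInt (r ^ 2) (k + 1) := by
        refine Finset.sum_le_sum fun i hi => ?_
        exact pow_le_pow_of_le_one (by positivity) (by nlinarith)
          (Nat.lt_succ_iff.mp (Finset.mem_range.mp hi))
      simp only [Finset.sum_const, Finset.card_range, nsmul_eq_mul, Nat.cast_add,
        Nat.cast_one] at h1
      refine le_trans ?_ h1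
      have : 0 ≤ ((k : ℝ) + 1) * (r ^ 2) ^ k := by positivity
      nlinarith
    have h := mul_nonneg (sub_nonneg.2 hr1) (sub_nonneg.2 key)
    rw [qInt_succ _ (k + 1)]
    have e := qInt_succ (r ^ 2) k
    have e' : (r ^ 2) ^ (k + 1) = r ^ 2 * (r ^ 2) ^ k := by ring
    rw [e']
    push_cast
    rw [e] at ih h ⊢
    nlinarith

/-! ### The three-term inequality -/

/-- The inequality between three consecutive coefficients `x, y, z` of a polynomial whose
coefficients extend at most `i` places below and `j` places above `y`. -/
def NewtonIneq (q : ℝ) (i j : ℕ) (x y z : ℝ) : Prop :=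
  qInt q (i + 1) * qInt q (j + 1) * (x * z) < q * qInt q i * qInt q j * y ^ 2

lemma mul_lt_mul_sq_of_ratio_le {α β α' β' B y : ℝ} (hα : 0 < α) (hβ : 0 < β) (hα' : 0 < α')
    (hβ' : 0 < β') (hr : α' * β ≤ α * β') (h : α * B < β * y ^ 2) : α' * B < β' * y ^ 2 := by
  rcases le_or_gt B 0 with hB | hB
  · rcases eq_or_ne y 0 with rfl | hy
    · have : α * B < 0 := by simpa using h
      have : B < 0 := by
        by_contra hc
        have := mul_nonneg hα.le (not_lt.1 hc)
        linarith
      simpa using mul_neg_of_pos_of_neg hα' this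
    · have : 0 < β' * y ^ 2 := by positivity
      nlinarith [mul_nonneg hα'.le (neg_nonneg.2 hB)]
  · refine lt_of_mul_lt_mul_left ?_ hβ.le
    calc β * (α' * B) = α' * β * B := by ring
      _ ≤ α * β' * B := by gcongr
      _ = β' * (α * B) := by ring
      _ < β' * (β * y ^ 2) := by gcongr
      _ = β * (β' * y ^ 2) := by ring

namespace NewtonIneq

variable {q : ℝ} {i j : ℕ} {x y z : ℝ}

lemma symm (h : NewtonIneq q i j x y z) : NewtonIneq q j i z y x := by
  unfold NewtonIneq at *
  linarith

lemma of_mul_eq_zero (hq : 0 < q) (hi : 1 ≤ i) (hj : 1 ≤ j) (hxz : x * z = 0) (hy : y ≠ 0) :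
    NewtonIneq q i j x y z := by
  unfold NewtonIneq
  have := qInt_pos hq hi
  have := qInt_pos hq hj
  rw [hxz, mul_zero]
  positivity

lemma succ_left (hq : 0 < q) (hi : 1 ≤ i) (hj : 1 ≤ j) (h : NewtonIneq q i j x y z) :
    NewtonIneq q (i + 1) j x y z := by
  have h1 := qInt_pos hq hi
  have h2 := qInt_pos hq hj
  have h3 := qInt_pos hq (Nat.le_add_left 1 i)
  have h4 := qInt_pos hq (Nat.le_add_left 1 j)
  have h5 := qInt_pos hq (Nat.le_add_left 1 (i + 1))
  refine mul_lt_mul_sq_of_ratio_le (by positivity) (by positivity) (by positivity)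
    (by positivity) ?_ h
  have := mul_le_mul_of_nonneg_left (qInt_mul_qInt_le hq i)
    (show 0 ≤ q * qInt q j * qInt q (j + 1) by positivity)
  linarith

lemma mono_left (hq : 0 < q) (hi : 1 ≤ i) (hj : 1 ≤ j) (h : NewtonIneq q i j x y z)
    {i' : ℕ} (hi' : i ≤ i') : NewtonIneq q i' j x y z := by
  induction i', hi' using Nat.le_induction with
  | base => exact h
  | succ k hk ih => exact ih.succ_left hq (hi.trans hk) hj

lemma mono (hq : 0 < q) (hi : 1 ≤ i) (hj : 1 ≤ j) (h : NewtonIneq q i j x y z)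
    {i' j' : ℕ} (hi' : i ≤ i') (hj' : j ≤ j') : NewtonIneq q i' j' x y z :=
  ((h.mono_left hq hi hj hi').symm.mono_left hq hj (hi.trans hi') hj').symm

lemma to_one (hq : 0 < q) (hq1 : q ≤ 1) (hi : 1 ≤ i) (hj : 1 ≤ j)
    (h : NewtonIneq q i j x y z) : NewtonIneq 1 i j x y z := by
  obtain ⟨r, hr, rfl⟩ : ∃ r, 0 < r ∧ q = r ^ 2 :=
    ⟨√q, Real.sqrt_pos.2 hq, (Real.sq_sqrt hq.le).symm⟩
  have hr1 : r ≤ 1 := by nlinarith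
  have h1 := qInt_pos hq hi
  have h2 := qInt_pos hq hj
  have h3 := qInt_pos hq (Nat.le_add_left 1 i)
  have h4 := qInt_pos hq (Nat.le_add_left 1 j)
  have hi0 : (0 : ℝ) < i := by exact_mod_cast hi
  have hj0 : (0 : ℝ) < j := by exact_mod_cast hj
  refine mul_lt_mul_sq_of_ratio_le (by positivity) (by positivity) ?_ ?_ ?_ h
  · simp only [qInt_one]; positivity
  · simp only [qInt_one]; positivity
  · simp only [qInt_one]
    have := mul_le_mul (mul_qInt_le_mul_qInt_succ hr hr1 i) (mul_qInt_le_mul_qInt_succ hr hr1 j)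
      (by positivity) (by positivity)
    push_cast
    linarith

/-- Transfer of the inequality through an operator multiplying the coefficients by the
quantum integers `[i], [i + 1], [i + 2]`. -/
lemma of_mul_qInt (hq : 0 < q) (hi : 1 ≤ i) {c u v w : ℝ} (hc : c ≠ 0)
    (huw : u * w = c ^ 2 * (qInt q i * qInt q (i + 2) * (x * z)))
    (hv : v ^ 2 = c ^ 2 * (qInt q (i + 1) ^ 2 * y ^ 2))
    (h : NewtonIneq q i j u v w) : NewtonIneq q (i + 1) j x y z := by
  have h1 := qInt_pos hq hi
  have h3 := qInt_pos hq (Nat.le_add_left 1 i)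
  unfold NewtonIneq at *
  rw [huw, hv] at h
  refine lt_of_mul_lt_mul_left (a := c ^ 2 * qInt q i * qInt q (i + 1)) ?_ (by positivity)
  linarith

end NewtonIneq

/-! ### Real-rooted polynomials with separated zeros -/

/-- `F` is a nonzero real-rooted polynomial whose nonzero zeros are simple and strictly
logarithmically `q`-separated. -/
structure IsSeparated (q : ℝ) (F : ℝ[X]) : Prop where
  ne_zero : F ≠ 0
  card_roots : F.roots.card = F.natDegree
  count_le_one : ∀ x ≠ 0, F.roots.count x ≤ 1
  eq_one_of_eval_eq_zero : ∀ s x, x ≠ 0 → q ≤ s → s ≤ 1 → F.eval x = 0 → F.eval (s * x) = 0 →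
    s = 1

/-- The set of nonzero roots of `F`. -/
noncomputable def nonzeroRoots (F : ℝ[X]) : Finset ℝ := F.roots.toFinset.erase 0

lemma mem_nonzeroRoots {F : ℝ[X]} (hF : F ≠ 0) {x : ℝ} :
    x ∈ nonzeroRoots F ↔ x ≠ 0 ∧ F.eval x = 0 := by
  simp [nonzeroRoots, hF]

lemma nonzeroRoots_eq_toFinset_filter (F : ℝ[X]) :
    nonzeroRoots F = (F.roots.filter (· ≠ 0)).toFinset := by
  ext x
  simp [nonzeroRoots, and_comm]

lemma card_filter_add_natTrailingDegree (F : ℝ[X]) :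
    (F.roots.filter (· ≠ 0)).card + F.natTrailingDegree = F.roots.card := by
  have h := congrArg Multiset.card (Multiset.filter_add_not (· ≠ 0) F.roots)
  rw [Multiset.card_add] at h
  rw [← rootMultiplicity_eq_natTrailingDegree', ← count_roots, ← h,
    Multiset.count_eq_card_filter_eq]
  congr 3
  ext x
  simp [eq_comm]

lemma card_nonzeroRoots_add_le (F : ℝ[X]) :
    (nonzeroRoots F).card + F.natTrailingDegree ≤ F.roots.card := by
  rw [← card_filter_add_natTrailingDegree, nonzeroRoots_eq_toFinset_filter]
  gcongr
  exact Multiset.toFinset_card_le _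

lemma IsSeparated.nodup_filter {q : ℝ} {F : ℝ[X]} (hF : IsSeparated q F) :
    (F.roots.filter (· ≠ 0)).Nodup := by
  rw [Multiset.nodup_iff_count_le_one]
  intro x
  rw [Multiset.count_filter]
  split_ifs with h
  · exact hF.count_le_one x h
  · simp

lemma IsSeparated.card_nonzeroRoots_add {q : ℝ} {F : ℝ[X]} (hF : IsSeparated q F) :
    (nonzeroRoots F).card + F.natTrailingDegree = F.natDegree := by
  rw [← hF.card_roots, ← card_filter_add_natTrailingDegree, nonzeroRoots_eq_toFinset_filter,
    Multiset.toFinset_card_of_nodup hF.nodup_filter]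

lemma eval_mul_eval_pos_of_no_root {G : ℝ[X]} {a b : ℝ}
    (h : ∀ y ∈ Set.uIcc a b, G.eval y ≠ 0) : 0 < G.eval a * G.eval b := by
  by_contra hc
  have h0 : (0 : ℝ) ∈ Set.uIcc (G.eval a) (G.eval b) := by
    rw [Set.mem_uIcc]
    rcases le_or_gt (G.eval a) 0 with ha | ha <;> rcases le_or_gt (G.eval b) 0 with hb | hb
    · have := h a Set.left_mem_uIcc
      have := h b Set.right_mem_uIcc
      exact absurd (mul_pos_of_neg_of_neg (lt_of_le_of_ne ha ‹_›) (lt_of_le_of_ne hb ‹_›)) hc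
    · exact Or.inl ⟨ha, hb.le⟩
    · exact Or.inr ⟨hb, ha.le⟩
    · exact absurd (mul_pos ha hb) hc
  obtain ⟨y, hy, hy0⟩ := intermediate_value_uIcc G.continuous.continuousOn h0
  exact h y hy hy0

lemma exists_root_of_eval_mul_eval_neg {G : ℝ[X]} {a b : ℝ} (hab : a < b)
    (h : G.eval a * G.eval b < 0) : ∃ z, a < z ∧ z < b ∧ G.eval z = 0 := by
  by_contra! hc
  refine absurd (eval_mul_eval_pos_of_no_root (G := G) (a := a) (b := b) fun y hy => ?_)
    (not_lt.2 h.le)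
  rw [Set.uIcc_of_le hab.le] at hy
  rcases eq_or_lt_of_le hy.1 with rfl | h1
  · exact left_ne_zero_of_mul h.ne
  rcases eq_or_lt_of_le hy.2 with rfl | h2
  · exact right_ne_zero_of_mul h.ne
  exact hc y h1 h2

/-- A polynomial changes sign across a simple root. -/
lemma eval_mul_eval_neg_of_simple_root {F : ℝ[X]} (hF : F ≠ 0) {a b x : ℝ}
    (hx : F.roots.count x = 1) (hab : (a - x) * (b - x) < 0)
    (h : ∀ y ∈ Set.uIcc a b, F.eval y = 0 → y = x) : F.eval a * F.eval b < 0 := by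
  rw [count_roots] at hx
  obtain ⟨G, hG, hGx⟩ := exists_eq_pow_rootMultiplicity_mul_and_not_dvd F hF x
  rw [hx, pow_one] at hG
  rw [dvd_iff_isRoot] at hGx
  have hpos : 0 < G.eval a * G.eval b := eval_mul_eval_pos_of_no_root fun y hy hy0 => by
    have : y = x := h y hy (by rw [hG]; simp [hy0])
    exact hGx (this ▸ hy0)
  have e : F.eval a * F.eval b = (a - x) * (b - x) * (G.eval a * G.eval b) := by
    rw [hG]; simp; ring
  rw [e]
  exact mul_neg_of_neg_of_pos hab hpos

namespace IsSeparated

variable {q : ℝ} {F : ℝ[X]}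

lemma count_eq_one (hF : IsSeparated q F) {x : ℝ} (hx : x ≠ 0) (h : F.eval x = 0) :
    F.roots.count x = 1 :=
  le_antisymm (hF.count_le_one x hx) (Multiset.one_le_count_iff_mem.2 (by simp [hF.ne_zero, h]))

lemma lt_mul_of_lt (hF : IsSeparated q F) {x y : ℝ} (hx : F.eval x = 0) (hy : F.eval y = 0)
    (hxy : x < y) (hx0 : 0 < x) : x < q * y := by
  by_contra! hc
  have hy0 : 0 < y := hx0.trans hxy
  have h := hF.eq_one_of_eval_eq_zero (x / y) y hy0.ne' ((le_div_iff₀ hy0).2 hc)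
    ((div_le_one hy0).2 hxy.le) hy (by rwa [div_mul_cancel₀ _ hy0.ne'])
  rw [div_eq_one_iff_eq hy0.ne'] at h
  exact hxy.ne h

lemma mul_lt_of_lt (hF : IsSeparated q F) {x y : ℝ} (hx : F.eval x = 0) (hy : F.eval y = 0)
    (hxy : x < y) (hy0 : y < 0) : q * x < y := by
  by_contra! hc
  have hx0 : x < 0 := hxy.trans hy0
  have h := hF.eq_one_of_eval_eq_zero (y / x) x hx0.ne ((le_div_iff_of_neg hx0).2 hc)
    ((div_le_one_of_neg hx0).2 hxy.le) hx (by rwa [div_mul_cancel₀ _ hx0.ne])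
  rw [div_eq_one_iff_eq hx0.ne] at h
  exact hxy.ne' h

/-- If `K` has at each nonzero root `x` of `F` the sign of `F (q x)`, then `K` has a root
between any two consecutive roots of `F` of the same sign. -/
lemma card_nonzeroRoots_le (hF : IsSeparated q F) (hq : 0 < q) (hq1 : q < 1) {K : ℝ[X]}
    (hK0 : K ≠ 0)
    (hK : ∀ x ≠ 0, F.eval x = 0 → 0 < K.eval x * F.eval (q * x)) :
    (nonzeroRoots F).card ≤ (nonzeroRoots K).card + 2 := by
  have key : (nonzeroRoots F).card ≤ (insert 0 (nonzeroRoots K)).card + 1 := by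
    refine Finset.card_le_of_interleaved fun x hx y hy hxy hcons => ?_
    rw [mem_nonzeroRoots hF.ne_zero] at hx hy
    have hcons' : ∀ z, x < z → z < y → z ≠ 0 → F.eval z ≠ 0 := fun z h1 h2 h3 h4 =>
      hcons z ((mem_nonzeroRoots hF.ne_zero).2 ⟨h3, h4⟩) ⟨h1, h2⟩
    have root : F.eval (q * x) * F.eval (q * y) < 0 →
        ∃ z, x < z ∧ z < y ∧ K.eval z = 0 := fun hneg => by
      refine exists_root_of_eval_mul_eval_neg hxy ?_
      by_contra! hc
      have := mul_pos (hK x hx.1 hx.2) (hK y hy.1 hy.2)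
      nlinarith [mul_nonneg hc (neg_nonneg.2 hneg.le)]
    rcases lt_or_gt_of_ne hx.1 with hx0 | hx0
    · rcases lt_or_gt_of_ne hy.1 with hy0 | hy0
      · have hqxy := hF.mul_lt_of_lt hx.2 hy.2 hxy hy0
        obtain ⟨z, h1, h2, h3⟩ := root <| by
          refine eval_mul_eval_neg_of_simple_root hF.ne_zero (hF.count_eq_one hy.1 hy.2)
            (mul_neg_of_neg_of_pos (by linarith) (by nlinarith)) fun t ht ht0 => ?_
          rw [Set.uIcc_of_le (by nlinarith)] at ht
          by_contra hty
          rcases lt_or_gt_of_ne hty with hlt | hgt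
          · exact hcons' t (by nlinarith [ht.1]) hlt (by linarith) ht0
          · nlinarith [hF.mul_lt_of_lt hy.2 ht0 hgt (by nlinarith [ht.2]), ht.2]
        exact ⟨z, Finset.mem_insert_of_mem ((mem_nonzeroRoots hK0).2 ⟨by linarith, h3⟩), h1, h2⟩
      · exact ⟨0, Finset.mem_insert_self _ _, hx0, hy0⟩
    · have hy0 : 0 < y := hx0.trans hxy
      have hqxy := hF.lt_mul_of_lt hx.2 hy.2 hxy hx0
      obtain ⟨z, h1, h2, h3⟩ := root <| by
        refine eval_mul_eval_neg_of_simple_root hF.ne_zero (hF.count_eq_one hx.1 hx.2)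
          (mul_neg_of_neg_of_pos (by nlinarith) (by linarith)) fun t ht ht0 => ?_
        rw [Set.uIcc_of_le (by nlinarith)] at ht
        by_contra hty
        rcases lt_or_gt_of_ne hty with hlt | hgt
        · nlinarith [hF.lt_mul_of_lt ht0 hx.2 hlt (by nlinarith [ht.1]), ht.1]
        · exact hcons' t hgt (by nlinarith [ht.2]) (by linarith) ht0
      exact ⟨z, Finset.mem_insert_of_mem ((mem_nonzeroRoots hK0).2 ⟨by linarith, h3⟩), h1, h2⟩
  have := Finset.card_insert_le 0 (nonzeroRoots K)
  omega

end IsSeparated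

/-- A real polynomial with all but at most one root real is real-rooted. -/
lemma card_roots_eq_natDegree_of_le {H : ℝ[X]} (h : H.natDegree ≤ H.roots.card + 1) :
    H.roots.card = H.natDegree := by
  obtain ⟨Q, -, hdeg, hroots⟩ := exists_prod_multiset_X_sub_C_mul H
  rcases Nat.eq_zero_or_pos Q.natDegree with h0 | h0
  · omega
  have h1 : Q.natDegree = 1 := by omega
  obtain ⟨x, hx⟩ := exists_root_of_degree_eq_one
    ((degree_eq_iff_natDegree_eq_of_pos one_pos).2 h1)
  have : x ∈ Q.roots := (mem_roots (by rintro rfl; simp at h1)).2 hx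
  simp [hroots] at this

/-- The operator `F(z) ↦ F(q z) - c F(z)`. -/
noncomputable def qShiftSub (q c : ℝ) (F : ℝ[X]) : ℝ[X] := F.comp (C q * X) - C c * F

lemma coeff_qShiftSub (q c : ℝ) (F : ℝ[X]) (k : ℕ) :
    (qShiftSub q c F).coeff k = F.coeff k * (q ^ k - c) := by
  rw [qShiftSub, coeff_sub, comp_C_mul_X_coeff, coeff_C_mul]
  ring

lemma eval_qShiftSub (q c : ℝ) (F : ℝ[X]) (x : ℝ) :
    (qShiftSub q c F).eval x = F.eval (q * x) - c * F.eval x := by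
  simp [qShiftSub]

namespace IsSeparated

variable {q c : ℝ} {F : ℝ[X]}

lemma eval_mul_ne_zero (hF : IsSeparated q F) (hq1 : q < 1) {x : ℝ} (hx : x ≠ 0)
    (h : F.eval x = 0) : F.eval (q * x) ≠ 0 := fun h' =>
  hq1.ne (hF.eq_one_of_eval_eq_zero q x hx le_rfl hq1.le h h')

/-- If `v` is a root of `F(q z) - c F(z)`, then the segment from `q v` to `v` contains no root
of `F`. -/
lemma eval_ne_zero_of_qShiftSub (hF : IsSeparated q F) (hq : 0 < q) (hq1 : q < 1) (hc : 0 < c)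
    {v s : ℝ} (hv : v ≠ 0) (h : (qShiftSub q c F).eval v = 0) (hs : q ≤ s) (hs1 : s ≤ 1) :
    F.eval (s * v) ≠ 0 := by
  intro h0
  rw [eval_qShiftSub, sub_eq_zero] at h
  have hs0 : 0 < s := hq.trans_le hs
  have hFv : F.eval v ≠ 0 := fun h1 =>
    hF.eval_mul_ne_zero hq1 hv h1 (by rw [h, h1, mul_zero])
  have hs1' : s < 1 := lt_of_le_of_ne hs1 (by rintro rfl; exact hFv (by simpa using h0))
  have hsq : q < s := lt_of_le_of_ne hs (by
    rintro rfl
    rw [h] at h0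
    exact (mul_ne_zero hc.ne' hFv) h0)
  have hv2 : 0 < v ^ 2 := by positivity
  have hneg : F.eval (q * v) * F.eval v < 0 := by
    refine eval_mul_eval_neg_of_simple_root hF.ne_zero
      (hF.count_eq_one (mul_ne_zero hs0.ne' hv) h0) ?_ fun y hy hy0 => ?_
    · have : (q * v - s * v) * (v - s * v) = -((s - q) * (1 - s) * v ^ 2) := by ring
      rw [this]
      exact neg_neg_of_pos (mul_pos (mul_pos (by linarith) (by linarith)) hv2)
    · obtain ⟨t, rfl, ht, ht1⟩ : ∃ t, y = t * v ∧ q ≤ t ∧ t ≤ 1 := by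
        refine ⟨y / v, (div_mul_cancel₀ _ hv).symm, ?_⟩
        rcases lt_or_gt_of_ne hv with h1 | h1
        · rw [Set.uIcc_of_ge (by nlinarith)] at hy
          exact ⟨(le_div_iff_of_neg h1).2 hy.2, (div_le_one_of_neg h1).2 hy.1⟩
        · rw [Set.uIcc_of_le (by nlinarith)] at hy
          exact ⟨(le_div_iff₀ h1).2 hy.1, (div_le_one h1).2 hy.2⟩
      have ht0 : 0 < t := hq.trans_le ht
      rcases le_total t s with hts | hts
      · have := hF.eq_one_of_eval_eq_zero (t / s) (s * v) (mul_ne_zero hs0.ne' hv)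
          ((le_div_iff₀ hs0).2 (by nlinarith)) ((div_le_one hs0).2 hts) h0
          (by rw [← mul_assoc, div_mul_cancel₀ _ hs0.ne']; exact hy0)
        rw [(div_eq_one_iff_eq hs0.ne').1 this]
      · have := hF.eq_one_of_eval_eq_zero (s / t) (t * v) (mul_ne_zero ht0.ne' hv)
          ((le_div_iff₀ ht0).2 (by nlinarith)) ((div_le_one ht0).2 hts) hy0
          (by rw [← mul_assoc, div_mul_cancel₀ _ ht0.ne']; exact h0)
        rw [(div_eq_one_iff_eq ht0.ne').1 this]
  rw [h] at hneg
  have : 0 < c * (F.eval v) ^ 2 := by positivity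
  nlinarith

lemma qShiftSub_mul_pos (hF : IsSeparated q F) (hq1 : q < 1) {x : ℝ} (hx : x ≠ 0)
    (h : F.eval x = 0) : 0 < (qShiftSub q c F).eval x * F.eval (q * x) := by
  rw [eval_qShiftSub, h, mul_zero, sub_zero]
  exact mul_self_pos.2 (hF.eval_mul_ne_zero hq1 hx h)

lemma natDegree_add_natTrailingDegree_le (hF : IsSeparated q F) (hq : 0 < q) (hq1 : q < 1)
    (hH0 : qShiftSub q c F ≠ 0) :
    F.natDegree + (qShiftSub q c F).natTrailingDegree ≤
      (qShiftSub q c F).roots.card + F.natTrailingDegree + 2 := by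
  have h1 := hF.card_nonzeroRoots_le hq hq1 hH0 fun x hx h => hF.qShiftSub_mul_pos hq1 hx h
  have h2 := hF.card_nonzeroRoots_add
  have h3 := card_nonzeroRoots_add_le (qShiftSub q c F)
  omega

/-- Two roots `t v, v` of `F(q z) - c F(z)` with `q ≤ t ≤ 1` force too many further roots. -/
lemma not_dvd_qShiftSub (hF : IsSeparated q F) (hq : 0 < q) (hq1 : q < 1) (hc : 0 < c)
    (hH0 : qShiftSub q c F ≠ 0)
    (hdeg : (qShiftSub q c F).natDegree + F.natTrailingDegree + 1 ≤
      F.natDegree + (qShiftSub q c F).natTrailingDegree)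
    {t v : ℝ} (hv : v ≠ 0) (ht : q ≤ t) (ht1 : t ≤ 1) :
    ¬ (X - C (t * v)) * (X - C v) ∣ qShiftSub q c F := by
  rintro ⟨K, hK⟩
  have hK0 : K ≠ 0 := by rintro rfl; simp [hH0] at hK
  have hX : (X - C (t * v)) * (X - C v) ≠ 0 := mul_ne_zero (X_sub_C_ne_zero _) (X_sub_C_ne_zero _)
  have ht0 : 0 < t := hq.trans_le ht
  have hd : (qShiftSub q c F).natDegree = K.natDegree + 2 := by
    rw [hK, natDegree_mul hX hK0, natDegree_mul (X_sub_C_ne_zero _) (X_sub_C_ne_zero _)]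
    simp only [natDegree_X_sub_C]
    omega
  have hm : (qShiftSub q c F).natTrailingDegree = K.natTrailingDegree := by
    have h0 : ∀ x : ℝ, x ≠ 0 → (X - C x).natTrailingDegree = 0 := fun x hx =>
      Nat.le_zero.1 (natTrailingDegree_le_of_ne_zero (by simpa using hx))
    rw [hK, natTrailingDegree_mul hX hK0,
      natTrailingDegree_mul (X_sub_C_ne_zero _) (X_sub_C_ne_zero _), h0 _ hv,
      h0 _ (mul_ne_zero ht0.ne' hv)]
    omega
  have hHv : (qShiftSub q c F).eval v = 0 := by rw [hK]; simp
  have h1 := hF.card_nonzeroRoots_le hq hq1 hK0 fun x hx h => by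
    have hpos := hF.qShiftSub_mul_pos (c := c) hq1 hx h
    have e : (qShiftSub q c F).eval x = (x - t * v) * (x - v) * K.eval x := by
      conv_lhs => rw [hK]
      simp
    rw [e, mul_assoc] at hpos
    refine (mul_pos_iff_of_pos_left ?_).1 hpos
    by_contra! hle
    obtain ⟨s, rfl⟩ : ∃ s, x = s * v := ⟨x / v, (div_mul_cancel₀ _ hv).symm⟩
    have hv2 : 0 < v ^ 2 := by positivity
    have hst : (s - t) * (s - 1) ≤ 0 := by
      refine nonpos_of_mul_nonpos_left ?_ hv2
      linarith
    exact hF.eval_ne_zero_of_qShiftSub hq hq1 hc hv hHv (s := s) (by nlinarith) (by nlinarith) h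
  have h2 := hF.card_nonzeroRoots_add
  have h3 := card_nonzeroRoots_add_le K
  have h4 := K.card_roots'
  omega

lemma isSeparated_qShiftSub (hF : IsSeparated q F) (hq : 0 < q) (hq1 : q < 1) (hc : 0 < c)
    (hH0 : qShiftSub q c F ≠ 0)
    (hdeg : (qShiftSub q c F).natDegree + F.natTrailingDegree + 1 ≤
      F.natDegree + (qShiftSub q c F).natTrailingDegree) :
    IsSeparated q (qShiftSub q c F) where
  ne_zero := hH0
  card_roots := by
    have := hF.natDegree_add_natTrailingDegree_le hq hq1 hH0
    exact card_roots_eq_natDegree_of_le (by omega)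
  count_le_one x hx := by
    by_contra! hcount
    rw [count_roots] at hcount
    refine hF.not_dvd_qShiftSub hq hq1 hc hH0 hdeg hx hq1.le le_rfl ?_
    rw [one_mul, ← sq]
    exact (le_rootMultiplicity_iff hH0).1 hcount
  eq_one_of_eval_eq_zero s x hx hs hs1 h h' := by
    by_contra hne
    refine hF.not_dvd_qShiftSub hq hq1 hc hH0 hdeg hx hs hs1 ?_
    refine IsCoprime.mul_dvd ?_ (dvd_iff_isRoot.2 h') (dvd_iff_isRoot.2 h)
    exact isCoprime_X_sub_C_of_isUnit_sub
      (sub_ne_zero.2 fun h => hne (by simpa [hx] using h)).isUnit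

end IsSeparated

/-! ### Induction on the number of nonzero roots -/

lemma coeff_ne_zero_of_extreme {F : ℝ[X]} (hF : F ≠ 0) {k : ℕ}
    (h : F.natTrailingDegree = k ∨ F.natDegree = k) : F.coeff k ≠ 0 := by
  rcases h with rfl | rfl <;> simpa using hF

namespace IsSeparated

variable {q : ℝ} {F : ℝ[X]}

/-- The case of exactly two nonzero roots. -/
lemma newtonIneq_of_natDegree_eq (hF : IsSeparated q F) (hq : 0 < q) (hq1 : q < 1) {k : ℕ}
    (hk : F.natTrailingDegree = k) (hd : F.natDegree = k + 2) :
    NewtonIneq q 1 1 (F.coeff k) (F.coeff (k + 1)) (F.coeff (k + 2)) := by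
  have hcard := card_filter_add_natTrailingDegree F
  rw [hF.card_roots, hk, hd, add_comm, Nat.add_left_cancel_iff, Multiset.card_eq_two] at hcard
  obtain ⟨r, s, hrs⟩ := hcard
  have hnd := hF.nodup_filter
  rw [hrs] at hnd
  have hne : r ≠ s := by simpa using hnd
  have hmem : ∀ x ∈ F.roots.filter (· ≠ 0), x ≠ 0 ∧ F.eval x = 0 := fun x hx => by
    simpa [hF.ne_zero, and_comm] using hx
  obtain ⟨hr0, hr⟩ := hmem r (by simp [hrs])
  obtain ⟨hs0, hs⟩ := hmem s (by simp [hrs])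
  have hfac : F = X ^ k * (C F.leadingCoeff * ((X - C r) * (X - C s))) := by
    have h := C_leadingCoeff_mul_prod_multiset_X_sub_C hF.card_roots
    rw [← Multiset.filter_add_not (· ≠ 0) F.roots, Multiset.map_add, Multiset.prod_add, hrs] at h
    have hz : F.roots.filter (fun x => ¬ x ≠ 0) = Multiset.replicate k 0 := by
      rw [← hk, ← rootMultiplicity_eq_natTrailingDegree', ← count_roots,
        ← Multiset.filter_eq']
      simp
    rw [hz] at h
    conv_lhs => rw [← h]
    simp
    ring
  set b := F.leadingCoeff with hb
  have hb0 : b ≠ 0 := leadingCoeff_ne_zero.2 hF.ne_zero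
  have hquad : C b * ((X - C r) * (X - C s)) =
      C b * X ^ 2 + C (-(b * (r + s))) * X + C (b * (r * s)) := by
    simp only [map_neg, map_mul, map_add]
    ring
  have h0 : F.coeff k = b * (r * s) := by
    have := coeff_X_pow_mul (C b * ((X - C r) * (X - C s))) k 0
    rw [← hfac, hquad] at this
    simpa using this
  have h1 : F.coeff (k + 1) = -(b * (r + s)) := by
    have := coeff_X_pow_mul (C b * ((X - C r) * (X - C s))) k 1
    rw [← hfac, hquad, add_comm] at this
    simpa [coeff_X, coeff_C] using this
  have h2 : F.coeff (k + 2) = b := by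
    have := coeff_X_pow_mul (C b * ((X - C r) * (X - C s))) k 2
    rw [← hfac, hquad, add_comm] at this
    simpa [coeff_X, coeff_C] using this
  have hb2 : 0 < b ^ 2 := by positivity
  have main : 0 < (q * r - s) * (r - q * s) := by
    obtain ⟨t, rfl⟩ : ∃ t, r = t * s := ⟨r / s, (div_mul_cancel₀ _ hs0).symm⟩
    have hs2 : 0 < s ^ 2 := by positivity
    have ht0 : t ≠ 0 := left_ne_zero_of_mul hr0
    have ht1 : t ≠ 1 := by rintro rfl; simp at hne
    have e : (q * (t * s) - s) * (t * s - q * s) = ((1 - q * t) * (q - t)) * s ^ 2 := by ring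
    rw [e]
    refine mul_pos ?_ hs2
    rcases lt_or_ge t q with h | h
    · exact mul_pos (by nlinarith) (by linarith)
    · have ht : 1 < t := by
        by_contra! hle
        exact ht1 (hF.eq_one_of_eval_eq_zero t s hs0 h hle hs hr)
      have hqt : 1 < q * t := by
        by_contra! hle
        have htp : 0 < t := by linarith
        have := hF.eq_one_of_eval_eq_zero t⁻¹ (t * s) hr0
          ((le_inv_comm₀ hq htp).2 (by rw [← one_div, le_div_iff₀ hq]; linarith))
          (inv_le_one_of_one_le₀ ht.le) hr (by rwa [inv_mul_cancel_left₀ ht0])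
        exact ht1 (by simpa using this)
      exact mul_pos_of_neg_of_neg (by linarith) (by linarith)
  unfold NewtonIneq
  rw [h0, h1, h2]
  have e1 : qInt q 1 = 1 := by simp [qInt]
  have e2 : qInt q (1 + 1) = 1 + q := by simp [qInt, Finset.sum_range_succ]
  rw [e1, e2]
  nlinarith [mul_pos hb2 main]

/-- The `q`-Newton inequalities for the coefficients of a polynomial with separated zeros. -/
theorem newtonIneq (hq : 0 < q) (hq1 : q < 1) (N : ℕ) : ∀ (F : ℝ[X]), IsSeparated q F →
    F.natDegree ≤ F.natTrailingDegree + N → ∀ k i j : ℕ, 1 ≤ i → 1 ≤ j →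
    k + 1 ≤ F.natTrailingDegree + i → F.natDegree ≤ k + 1 + j →
    F.natTrailingDegree ≤ k + 1 → k + 1 ≤ F.natDegree →
    NewtonIneq q i j (F.coeff k) (F.coeff (k + 1)) (F.coeff (k + 2)) := by
  induction N with
  | zero =>
    intro F hF hN k i j hi hj hki hkj hm hM
    refine NewtonIneq.of_mul_eq_zero hq hi hj ?_ (coeff_ne_zero_of_extreme hF.ne_zero ?_)
    · rw [coeff_eq_zero_of_lt_natTrailingDegree (by omega), zero_mul]
    · omega
  | succ N ih =>
    intro F hF hN k i j hi hj hki hkj hm hM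
    rcases eq_or_lt_of_le hm with hm' | hm'
    · refine NewtonIneq.of_mul_eq_zero hq hi hj ?_ (coeff_ne_zero_of_extreme hF.ne_zero (.inl hm'))
      rw [coeff_eq_zero_of_lt_natTrailingDegree (by omega), zero_mul]
    rcases eq_or_lt_of_le hM with hM' | hM'
    · refine NewtonIneq.of_mul_eq_zero hq hi hj ?_
        (coeff_ne_zero_of_extreme hF.ne_zero (.inr hM'.symm))
      rw [coeff_eq_zero_of_natDegree_lt (n := k + 2) (by omega), mul_zero]
    obtain ⟨i₀, hi₀⟩ : ∃ i₀, k = F.natTrailingDegree + i₀ :=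
      Nat.exists_eq_add_of_le (by omega)
    obtain ⟨j₀, hj₀⟩ : ∃ j₀, F.natDegree = k + 2 + j₀ := Nat.exists_eq_add_of_le (by omega)
    refine NewtonIneq.mono (i := i₀ + 1) (j := j₀ + 1) hq (by omega) (by omega) ?_
      (by omega) (by omega)
    set m := F.natTrailingDegree with hmdef
    have hFm : F.coeff m ≠ 0 := coeff_ne_zero_of_extreme hF.ne_zero (.inl rfl)
    have hFM : F.coeff F.natDegree ≠ 0 := coeff_ne_zero_of_extreme hF.ne_zero (.inr rfl)
    have hpow : ∀ a b : ℕ, a < b → q ^ b - q ^ a ≠ 0 := fun a b hab =>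
      sub_ne_zero.2 (pow_lt_pow_right_of_lt_one₀ hq hq1 hab).ne
    have hgeo : ∀ a b : ℕ, q ^ (a + b) - q ^ a = -(q ^ a * (1 - q)) * qInt q b := fun a b => by
      have := one_sub_mul_qInt q b
      rw [pow_add]
      linear_combination q ^ a * this
    have hq1' : (1 - q) ≠ 0 := by linarith
    rcases Nat.eq_zero_or_pos i₀ with rfl | hi₀p
    · rcases Nat.eq_zero_or_pos j₀ with rfl | hj₀p
      · exact hF.newtonIneq_of_natDegree_eq hq hq1 (by omega) (by omega)
      · obtain ⟨H, hHdef⟩ : ∃ H, H = qShiftSub q (q ^ F.natDegree) F := ⟨_, rfl⟩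
        have hcoeff : ∀ l, H.coeff l = F.coeff l * (q ^ l - q ^ F.natDegree) := fun l => by
          rw [hHdef, coeff_qShiftSub]
        have hHm : H.coeff m ≠ 0 := by
          rw [hcoeff, ← neg_sub (q ^ F.natDegree)]
          exact mul_ne_zero hFm (neg_ne_zero.2 (hpow _ _ (by omega)))
        have hH0 : H ≠ 0 := by rintro rfl; simp at hHm
        have hm1 : H.natTrailingDegree ≤ m := natTrailingDegree_le_of_ne_zero hHm
        have hm2 : m ≤ H.natTrailingDegree := le_natTrailingDegree hH0 fun l hl => by
          rw [hcoeff, coeff_eq_zero_of_lt_natTrailingDegree hl, zero_mul]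
        have hM1 : H.natDegree ≤ F.natDegree - 1 := natDegree_le_iff_coeff_eq_zero.2 fun l hl => by
          rw [hcoeff]
          rcases eq_or_lt_of_le (show F.natDegree ≤ l by omega) with rfl | hl'
          · simp
          · rw [coeff_eq_zero_of_natDegree_lt hl', zero_mul]
        have hc : 0 < q ^ F.natDegree := by positivity
        have hHs : IsSeparated q H := by
          rw [hHdef] at *
          exact hF.isSeparated_qShiftSub hq hq1 hc hH0 (by omega)
        have hM2 : F.natDegree ≤ H.natDegree + 2 := by
          have := hF.natDegree_add_natTrailingDegree_le hq hq1 (c := q ^ F.natDegree)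
            (by rwa [← hHdef])
          rw [← hHdef, hHs.card_roots] at this
          omega
        have h := ih H hHs (by omega) k 1 j₀ le_rfl hj₀p (by omega) (by omega) (by omega)
          (by omega)
        have hd : ∀ a b : ℕ, a + b = F.natDegree →
            H.coeff a = F.coeff a * (q ^ a * (1 - q) * qInt q b) := fun a b hab => by
          rw [hcoeff, ← hab]
          linear_combination (-F.coeff a) * hgeo a b
        rw [hd k (j₀ + 2) (by omega), hd (k + 1) (j₀ + 1) (by omega),
          hd (k + 2) j₀ (by omega)] at h
        refine (NewtonIneq.of_mul_qInt hq hj₀p (c := q ^ (k + 1) * (1 - q))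
          (mul_ne_zero (by positivity) hq1') ?_ ?_ h.symm).symm <;> ring
    · obtain ⟨H, hHdef⟩ : ∃ H, H = qShiftSub q (q ^ m) F := ⟨_, rfl⟩
      have hcoeff : ∀ l, H.coeff l = F.coeff l * (q ^ l - q ^ m) := fun l => by
        rw [hHdef, coeff_qShiftSub]
      have hHM : H.coeff F.natDegree ≠ 0 := by
        rw [hcoeff]
        exact mul_ne_zero hFM (hpow _ _ (by omega))
      have hH0 : H ≠ 0 := by rintro rfl; simp at hHM
      have hM1 : F.natDegree ≤ H.natDegree := le_natDegree_of_ne_zero hHM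
      have hM2 : H.natDegree ≤ F.natDegree := natDegree_le_iff_coeff_eq_zero.2 fun l hl => by
        rw [hcoeff, coeff_eq_zero_of_natDegree_lt hl, zero_mul]
      have hm1 : m + 1 ≤ H.natTrailingDegree := le_natTrailingDegree hH0 fun l hl => by
        rw [hcoeff]
        rcases eq_or_lt_of_le (Nat.lt_succ_iff.1 hl) with rfl | hl'
        · simp
        · rw [coeff_eq_zero_of_lt_natTrailingDegree hl', zero_mul]
      have hc : 0 < q ^ m := by positivity
      have hHs : IsSeparated q H := by
        rw [hHdef] at *
        exact hF.isSeparated_qShiftSub hq hq1 hc hH0 (by omega)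
      have hm2 : H.natTrailingDegree ≤ m + 2 := by
        have := hF.natDegree_add_natTrailingDegree_le hq hq1 (c := q ^ m) (by rwa [← hHdef])
        rw [← hHdef, hHs.card_roots] at this
        omega
      have h := ih H hHs (by omega) k i₀ (j₀ + 1) hi₀p (by omega) (by omega) (by omega)
        (by omega) (by omega)
      have hd : ∀ a b : ℕ, a = m + b →
          H.coeff a = F.coeff a * (-(q ^ m * (1 - q)) * qInt q b) := fun a b hab => by
        rw [hcoeff, hab, hgeo m b]
      rw [hd k i₀ hi₀, hd (k + 1) (i₀ + 1) (by omega), hd (k + 2) (i₀ + 2) (by omega)] at h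
      refine NewtonIneq.of_mul_qInt hq hi₀p (c := q ^ m * (1 - q))
        (mul_ne_zero (by positivity) hq1') ?_ ?_ h <;> ring

end IsSeparated

/-! ### `q`-binomial coefficients -/

lemma qBinom_zero_left (q : ℝ) (k : ℕ) : qBinom 0 k q = if k = 0 then 1 else 0 := by
  simp [qBinom, Rpoly, coeff_one]

lemma Rpoly_succ (n : ℕ) (q : ℝ) : Rpoly (n + 1) q = Rpoly n q + C (q ^ n) * (Rpoly n q * X) := by
  rw [Rpoly, Finset.prod_range_succ, ← Rpoly]
  ring

lemma qBinom_succ_zero (n : ℕ) (q : ℝ) : qBinom (n + 1) 0 q = qBinom n 0 q := by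
  simp [qBinom, Rpoly_succ]

lemma qBinom_succ_succ (n k : ℕ) (q : ℝ) :
    qBinom (n + 1) (k + 1) q = qBinom n (k + 1) q + q ^ n * qBinom n k q := by
  rw [qBinom, qBinom, qBinom, Rpoly_succ, coeff_add, coeff_C_mul, coeff_mul_X]

lemma qBinom_nonneg {q : ℝ} (hq : 0 < q) (n k : ℕ) : 0 ≤ qBinom n k q := by
  induction n generalizing k with
  | zero => rw [qBinom_zero_left]; split_ifs <;> norm_num
  | succ n ih =>
    cases k with
    | zero => rw [qBinom_succ_zero]; exact ih 0
    | succ k =>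
      rw [qBinom_succ_succ]
      have := ih k
      have := ih (k + 1)
      positivity

lemma qBinom_pos {q : ℝ} (hq : 0 < q) {n k : ℕ} (hk : k ≤ n) : 0 < qBinom n k q := by
  induction n generalizing k with
  | zero => simp [qBinom_zero_left, Nat.le_zero.1 hk]
  | succ n ih =>
    cases k with
    | zero => rw [qBinom_succ_zero]; exact ih (Nat.zero_le _)
    | succ k =>
      rw [qBinom_succ_succ]
      have := ih (Nat.succ_le_succ_iff.1 hk)
      have := qBinom_nonneg hq n (k + 1)
      positivity

lemma qBinom_eq_zero (q : ℝ) {n k : ℕ} (hk : n < k) : qBinom n k q = 0 := by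
  induction n generalizing k with
  | zero => simp [qBinom_zero_left, hk.ne']
  | succ n ih =>
    obtain ⟨k, rfl⟩ := Nat.exists_eq_add_of_lt hk
    rw [qBinom_succ_succ, ih (by omega), ih (by omega), mul_zero, add_zero]

/-- The recurrence `[k+1] C_{k+1} = q ^ k [n-k] C_k`. -/
lemma qInt_mul_qBinom (q : ℝ) (k j : ℕ) :
    qInt q (k + 1) * qBinom (k + j) (k + 1) q = q ^ k * qInt q j * qBinom (k + j) k q := by
  obtain ⟨n, hn⟩ : ∃ n, n = k + j := ⟨_, rfl⟩
  rw [← hn]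
  induction n generalizing k j with
  | zero =>
    obtain ⟨rfl, rfl⟩ : k = 0 ∧ j = 0 := by omega
    simp [qBinom_zero_left, qInt_zero]
  | succ n ih =>
    rcases j with _ | j
    · rw [qBinom_eq_zero q (by omega), qInt_zero]; simp
    · have h1 := ih k j (by omega)
      cases k with
      | zero =>
        rw [qBinom_succ_succ, qBinom_succ_zero]
        have e : qInt q (0 + 1) = 1 := by simp [qInt]
        obtain rfl : n = j := by omega
        rw [e] at h1 ⊢
        rw [qInt_succ]
        linear_combination h1
      | succ k =>
        have h2 := ih k (j + 1) (by omega)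
        rw [qBinom_succ_succ, qBinom_succ_succ]
        obtain rfl : n = k + 1 + j := by omega
        have e : qInt q (k + 1 + 1) = 1 + q * qInt q (k + 1) := by
          rw [qInt, qInt, Finset.sum_range_succ', Finset.mul_sum, add_comm]
          simp only [pow_succ', pow_zero]
        rw [qInt_succ q j] at h2 ⊢
        rw [mul_add, h1, e]
        linear_combination (q ^ (k + 1 + j) * q) * h2

lemma coeff_sum_C_mul_X_pow_range (n : ℕ) (b : ℕ → ℝ) (k : ℕ) :
    (∑ l ∈ Finset.range (n + 1), C (b l) * X ^ l : ℝ[X]).coeff k = if k ≤ n then b k else 0 := by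
  simp [coeff_X_pow]

/-! ### Assembly -/

lemma StrictLogSep.exists_isSeparated {q : ℝ} (hq : 0 < q) (hq1 : q ≤ 1) {F : ℝ[X]}
    (hF : F ≠ 0) (hroots : F.roots.card = F.natDegree) (h : StrictLogSep q F.roots) :
    ∃ q', 0 < q' ∧ q' < 1 ∧ (q' = q ∨ q = 1) ∧ IsSeparated q' F := by
  have hmem : ∀ x, F.eval x = 0 → x ∈ F.roots := fun x hx => by simp [hF, hx]
  have hcount : ∀ x ≠ 0, F.roots.count x ≤ 1 := fun x hx => by
    by_contra! hc
    have := h.1 x (Multiset.count_pos.1 (by omega)) hx hc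
    linarith
  have hsep : ∃ q', 0 < q' ∧ q' < 1 ∧ (q' = q ∨ q = 1) ∧
      ∀ x ∈ F.roots, ∀ y ∈ F.roots, ((y < x ∧ x < 0) ∨ (0 < x ∧ x < y)) → x / y < q' := by
    rcases eq_or_lt_of_le hq1 with rfl | hlt
    · have hev : ∀ᶠ t in nhdsWithin (1 : ℝ) (Set.Iio 1), ∀ x ∈ F.roots.toFinset,
          ∀ y ∈ F.roots.toFinset, ((y < x ∧ x < 0) ∨ (0 < x ∧ x < y)) → x / y < t := by
        rw [Filter.eventually_all_finset]
        intro x hx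
        rw [Filter.eventually_all_finset]
        intro y hy
        rw [Filter.eventually_imp_distrib_left]
        intro hxy
        exact Filter.Eventually.filter_mono nhdsWithin_le_nhds
          (lt_mem_nhds (h.2 x (Multiset.mem_toFinset.1 hx) y (Multiset.mem_toFinset.1 hy) hxy))
      have hpos : ∀ᶠ t in nhdsWithin (1 : ℝ) (Set.Iio 1), (0 : ℝ) < t :=
        Filter.Eventually.filter_mono nhdsWithin_le_nhds (lt_mem_nhds one_pos)
      obtain ⟨t, ⟨h1, h2⟩, h3⟩ := ((hev.and hpos).and self_mem_nhdsWithin).exists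
      exact ⟨t, h2, h3, .inr rfl, fun x hx y hy =>
        h1 x (Multiset.mem_toFinset.2 hx) y (Multiset.mem_toFinset.2 hy)⟩
    · exact ⟨q, hq, hlt, .inl rfl, h.2⟩
  obtain ⟨q', hq', hq1', hqq, hs⟩ := hsep
  refine ⟨q', hq', hq1', hqq, hF, hroots, hcount, fun s x hx hqs hs1 h0 h1 => ?_⟩
  by_contra hne
  have hs1' : s < 1 := lt_of_le_of_ne hs1 hne
  have hs0 : 0 < s := hq'.trans_le hqs
  have := hs (s * x) (hmem _ h1) x (hmem _ h0) (by
    rcases lt_or_gt_of_ne hx with h | h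
    · exact .inl ⟨by nlinarith, mul_neg_of_pos_of_neg hs0 h⟩
    · exact .inr ⟨mul_pos hs0 h, by nlinarith⟩)
  rw [mul_div_cancel_right₀ _ hx] at this
  linarith

lemma coeff_prod_X_sub_C_nonneg (s : Multiset ℝ) (hs : ∀ x ∈ s, x ≤ 0) (k : ℕ) :
    0 ≤ ((s.map fun x => X - C x).prod).coeff k := by
  induction s using Multiset.induction_on generalizing k with
  | empty => simp only [Multiset.map_zero, Multiset.prod_zero, coeff_one]; split_ifs <;> norm_num
  | cons x s ih =>
    have hx := hs x (Multiset.mem_cons_self x s)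
    have ih := ih fun y hy => hs y (Multiset.mem_cons_of_mem hy)
    rw [Multiset.map_cons, Multiset.prod_cons, sub_mul, coeff_sub, coeff_C_mul]
    have h2 := mul_nonneg (neg_nonneg.2 hx) (ih k)
    cases k with
    | zero => simp only [coeff_X_mul_zero]; linarith
    | succ k => rw [coeff_X_mul]; linarith [ih k]

/-- The coefficients of a real-rooted polynomial without positive roots have the same sign. -/
lemma RealRooted.coeff_nonneg_or_nonpos {F : ℝ[X]} (hF : RealRooted F) (h : OnlyNonposRoots F) :
    (∀ k, 0 ≤ F.coeff k) ∨ ∀ k, F.coeff k ≤ 0 := by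
  rcases hF with rfl | hF
  · simp
  have e := C_leadingCoeff_mul_prod_multiset_X_sub_C hF
  have hp := coeff_prod_X_sub_C_nonneg F.roots h
  rw [← e]
  simp only [coeff_C_mul]
  rcases le_total 0 F.leadingCoeff with hl | hl
  · exact .inl fun k => mul_nonneg hl (hp k)
  · exact .inr fun k => mul_nonpos_of_nonpos_of_nonneg hl (hp k)

/-- q-extension of Newton's inequalities: if
`F = ∑ C_k^n(q) a_k z^k ∈ 𝓡_n(q)` then `f = ∑ a_k z^k ∈ 𝓛𝓒_n`; if moreover
`F ∈ 𝓝_n(q)` then `f ∈ 𝓛𝓒_n⁺`. -/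
theorem stmt7 (n : ℕ) (hn : 1 ≤ n) (q : ℝ) (hq0 : 0 < q) (hq1 : q ≤ 1)
    (a : ℕ → ℝ) (ha : ∀ k, n < k → a k = 0) (F : Polynomial ℝ)
    (hFdef : F = ∑ k ∈ Finset.range (n + 1),
      Polynomial.C (qBinom n k q * a k) * Polynomial.X ^ k)
    (hF : memR n q F) :
    LCcond n a ∧
    (memN n q F → LCcond n a ∧ ((∀ k, 0 ≤ a k) ∨ (∀ k, a k ≤ 0))) := by
  have hcoeff : ∀ k ≤ n, F.coeff k = qBinom n k q * a k := fun k hk => by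
    rw [hFdef, coeff_sum_C_mul_X_pow_range, if_pos hk]
  obtain ⟨-, hreal, hsep⟩ := hF
  have hLC : LCcond n a := by
    rintro k hk ⟨l, hl, hal⟩ ⟨m, hkm, hmn, ham⟩
    have hFl : F.coeff l ≠ 0 := by
      rw [hcoeff l (hl.trans hk)]
      exact mul_ne_zero (qBinom_pos hq0 (hl.trans hk)).ne' hal
    have hFm : F.coeff m ≠ 0 := by
      rw [hcoeff m hmn]
      exact mul_ne_zero (qBinom_pos hq0 hmn).ne' ham
    rcases k with _ | p
    · obtain rfl : l = 0 := by omega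
      simp only [if_true, zero_mul]
      positivity
    rcases eq_or_lt_of_le hk with rfl | hlt
    · obtain rfl : m = p + 1 := by omega
      rw [ha _ (Nat.lt_succ_self _), mul_zero]
      positivity
    obtain ⟨j, rfl⟩ : ∃ j, n = p + 1 + j := Nat.exists_eq_add_of_le hk
    have hF0 : F ≠ 0 := by rintro rfl; simp at hFl
    have hdeg : F.natDegree ≤ p + 1 + j := natDegree_le_iff_coeff_eq_zero.2 fun i hi => by
      rw [hFdef, coeff_sum_C_mul_X_pow_range, if_neg (by omega)]
    obtain ⟨q', hq', hq1', hqq, hFs⟩ :=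
      hsep.exists_isSeparated hq0 hq1 hF0 (hreal.resolve_left hF0)
    have h := IsSeparated.newtonIneq hq' hq1' F.natDegree F hFs (by omega) p (p + 1) j (by omega)
      (by omega) (by omega) hdeg ((natTrailingDegree_le_of_ne_zero hFl).trans hl)
      (hkm.trans (le_natDegree_of_ne_zero hFm))
    have h' : NewtonIneq q (p + 1) j (F.coeff p) (F.coeff (p + 1)) (F.coeff (p + 2)) := by
      rcases hqq with rfl | rfl
      · exact h
      · exact h.to_one hq' hq1'.le (by omega) (by omega)
    rw [hcoeff p (by omega), hcoeff (p + 1) hk, hcoeff (p + 2) hlt] at h'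
    have e1 := qInt_mul_qBinom q p (j + 1)
    rw [show p + (j + 1) = p + 1 + j by omega] at e1
    have e2 := qInt_mul_qBinom q (p + 1) j
    have hC := qBinom_pos hq0 hk
    have hp1 := qInt_pos hq0 (Nat.le_add_left 1 p)
    have hj1 := qInt_pos hq0 (show 1 ≤ j by omega)
    rw [if_neg (Nat.succ_ne_zero p), Nat.add_sub_cancel]
    set W := q ^ (p + 1) * qInt q (p + 1) * qInt q j * qBinom (p + 1 + j) (p + 1) q ^ 2 with hW
    have hWpos : 0 < W := by positivity
    refine lt_of_mul_lt_mul_left (a := W) ?_ hWpos.le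
    have hqp : 0 < q ^ p := by positivity
    have h'' := mul_lt_mul_of_pos_left h' hqp
    have el : q ^ p * (qInt q (p + 1 + 1) * qInt q (j + 1) *
        (qBinom (p + 1 + j) p q * a p * (qBinom (p + 1 + j) (p + 2) q * a (p + 2)))) =
        W * (a p * a (p + 1 + 1)) := by
      calc _ = (q ^ p * qInt q (j + 1) * qBinom (p + 1 + j) p q) *
            (qInt q (p + 1 + 1) * qBinom (p + 1 + j) (p + 1 + 1) q) *
            (a p * a (p + 1 + 1)) := by ring
        _ = _ := by rw [← e1, e2, hW]; ring
    rw [el] at h''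
    refine h''.trans_eq ?_
    rw [hW]
    ring
  refine ⟨hLC, fun hN => ⟨hLC, ?_⟩⟩
  rcases hreal.coeff_nonneg_or_nonpos hN.2 with h | h
  · refine .inl fun k => ?_
    rcases le_or_gt k n with hk | hk
    · have := h k
      rw [hcoeff k hk] at this
      exact nonneg_of_mul_nonneg_right this (qBinom_pos hq0 hk)
    · exact (ha k hk).ge
  · refine .inr fun k => ?_
    rcases le_or_gt k n with hk | hk
    · have := h k
      rw [hcoeff k hk] at this
      exact nonpos_of_mul_nonpos_right this (qBinom_pos hq0 hk)
    · exact (ha k hk).le
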